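/- Let C and D be types, 𝓕 a filter on C, 𝓖 a filter on D, and f : C → D a function with Filter.Tendsto f 𝓕 𝓖. Then the following are equivalent: (1) for every type E (in the same universe as C and D), every filter 𝓗 on E, and all functions g₁, g₂ : E → C with Filter.Tendsto g₁ 𝓗 𝓕 and Filter.Tendsto g₂ 𝓗 𝓕, if f ∘ g₁ =ᶠ[𝓗] f ∘ g₂ then g₁ =ᶠ[𝓗] g₂; (2) there exists a set U ∈ 𝓕 such that f restricted to U is injective (Set.InjOn f U). -/

import Mathlib

universe u

theorem filter_mono_iff_injOn_base {C D : Type u} (𝓕 : Filter C) (𝓖 : Filter D)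
    (f : C → D) (hf : Filter.Tendsto f 𝓕 𝓖) :
    (∀ (E : Type u) (𝓗 : Filter E) (g₁ g₂ : E → C),
        Filter.Tendsto g₁ 𝓗 𝓕 → Filter.Tendsto g₂ 𝓗 𝓕 →
        (f ∘ g₁) =ᶠ[𝓗] (f ∘ g₂) → g₁ =ᶠ[𝓗] g₂) ↔
      ∃ U ∈ 𝓕, Set.InjOn f U := by
  constructor
  · intro h
    have hev := h (C × C) ((𝓕 ×ˢ 𝓕) ⊓ Filter.principal {p | f p.1 = f p.2}) Prod.fst Prod.snd
      (Filter.tendsto_fst.mono_left inf_le_left) (Filter.tendsto_snd.mono_left inf_le_left)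
      (Filter.mem_inf_of_right (Filter.mem_principal_self _))
    obtain ⟨U, hU, hUsub⟩ := Filter.mem_prod_same_iff.1 (Filter.mem_inf_principal.1 hev)
    exact ⟨U, hU, fun x hx y hy hxy => hUsub (Set.mk_mem_prod hx hy) hxy⟩
  · rintro ⟨U, hU, hinj⟩ E 𝓗 g₁ g₂ h₁ h₂ heq
    filter_upwards [h₁ hU, h₂ hU, heq] with e he₁ he₂ he
    exact hinj he₁ he₂ he
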